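/- Every convex hexagon has an ear (a triangle formed by three consecutive vertices) whose area is at most 1/6 of the area of the hexagon; equivalently, every convex hexagon contains a convex pentagon on five of its vertices whose area is at least 5/6 of the area of the hexagon. -/

import Mathlib

open MeasureTheory

/-- The area of a planar point set: the Lebesgue measure of its convex hull. -/
noncomputable def area (S : Set (ℝ × ℝ)) : ℝ :=
  (volume (convexHull ℝ S)).toReal

/-- Points in strictly convex position, affinely spanning the plane. -/
def StrictConvexPos {n : ℕ} (p : Fin n → ℝ × ℝ) : Prop :=
  (∀ i : Fin n, p i ∉ convexHull ℝ (p '' {j | j ≠ i})) ∧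
    affineSpan ℝ (Set.range p) = ⊤

/-- The cross product (twice the signed area) of the triangle `a b c`. -/
def Cross (a b c : ℝ × ℝ) : ℝ :=
  (b.1 - a.1) * (c.2 - a.2) - (b.2 - a.2) * (c.1 - a.1)

/-- The vertices `p 0, p 1, …, p (n-1)` are labeled in cyclic order around their
convex hull: all remaining vertices lie strictly on one and the same side of
each directed edge `p i → p (i+1)`. -/
def ConvexCyclic {n : ℕ} [NeZero n] (p : Fin n → ℝ × ℝ) : Prop :=
  (∀ i j : Fin n, j ≠ i → j ≠ i + 1 → 0 < Cross (p i) (p (i + 1)) (p j)) ∨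
  (∀ i j : Fin n, j ≠ i → j ≠ i + 1 → Cross (p i) (p (i + 1)) (p j) < 0)


theorem cross_rotate (a b c : ℝ × ℝ) : Cross b c a = Cross a b c := by
  simp only [Cross]; ring

theorem cross_swap (a b c : ℝ × ℝ) : Cross b a c = -Cross a b c := by
  simp only [Cross]; ring

theorem cross_left (a b : ℝ × ℝ) : Cross a b a = 0 := by
  simp only [Cross]; ring

theorem cross_right (a b : ℝ × ℝ) : Cross a b b = 0 := by
  simp only [Cross]; ring

theorem cross_combo (a b x y : ℝ × ℝ) {s t : ℝ} (h : s + t = 1) :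
    Cross a b (s • x + t • y) = s * Cross a b x + t * Cross a b y := by
  obtain rfl : s = 1 - t := by linarith
  simp only [Cross, Prod.fst_add, Prod.snd_add, Prod.smul_fst, Prod.smul_snd, smul_eq_mul]
  ring

theorem convex_cross_nonneg (a b : ℝ × ℝ) : Convex ℝ {x | 0 ≤ Cross a b x} := by
  intro x hx y hy s t hs ht h
  simp only [Set.mem_ofPred_eq] at *
  rw [cross_combo a b x y h]
  positivity

theorem convex_lt_cross (a b : ℝ × ℝ) (r : ℝ) : Convex ℝ {x | r < Cross a b x} := by
  intro x hx y hy s t hs ht h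
  simp only [Set.mem_ofPred_eq] at *
  rw [cross_combo a b x y h]
  exact (convex_Ioi r) hx hy hs ht h

theorem cross_nonneg_of_mem_convexHull {a b : ℝ × ℝ} {s : Set (ℝ × ℝ)}
    (h : ∀ x ∈ s, 0 ≤ Cross a b x) {x : ℝ × ℝ} (hx : x ∈ convexHull ℝ s) :
    0 ≤ Cross a b x :=
  convexHull_min (t := {x | 0 ≤ Cross a b x}) h (convex_cross_nonneg a b) hx

/-- The diagonals of a convex quadrilateral meet. -/
theorem exists_mem_diagonals {a b c d : ℝ × ℝ} (habc : 0 < Cross a b c) (hbcd : 0 < Cross b c d)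
    (hcda : 0 < Cross c d a) (hdab : 0 < Cross d a b) :
    ∃ x, x ∈ segment ℝ a c ∧ x ∈ segment ℝ b d := by
  have hS : Cross a b c + Cross c d a = Cross b c d + Cross d a b := by
    simp only [Cross]; ring
  have hpos : 0 < Cross b c d + Cross d a b := by positivity
  refine ⟨(Cross b c d / (Cross b c d + Cross d a b)) • a +
    (Cross d a b / (Cross b c d + Cross d a b)) • c,
    ⟨_, _, by positivity, by positivity, by field_simp, rfl⟩,
    ⟨Cross c d a / (Cross b c d + Cross d a b), Cross a b c / (Cross b c d + Cross d a b),
      by positivity, by positivity, by field_simp; linarith, ?_⟩⟩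
  ext
  · simp only [Prod.fst_add, Prod.smul_fst, smul_eq_mul]
    field_simp
    simp only [Cross]; ring
  · simp only [Prod.snd_add, Prod.smul_snd, smul_eq_mul]
    field_simp
    simp only [Cross]; ring

theorem cross_eq_zero_of_mem_segment {a b x y : ℝ × ℝ} (hx : x ∈ segment ℝ a b)
    (hy : y ∈ segment ℝ a b) : Cross x a y = 0 ∧ Cross x b y = 0 := by
  obtain ⟨s, t, -, -, h, rfl⟩ := hx
  obtain ⟨u, v, -, -, h', rfl⟩ := hy
  obtain rfl : s = 1 - t := by linarith
  obtain rfl : u = 1 - v := by linarith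
  constructor <;>
  · simp only [Cross, Prod.fst_add, Prod.snd_add, Prod.smul_fst, Prod.smul_snd, smul_eq_mul]
    ring

theorem lt_cross_of_mem_segment {a b c d x : ℝ × ℝ} {r : ℝ} (hc : r < Cross a b c)
    (hd : r < Cross a b d) (hx : x ∈ segment ℝ c d) : r < Cross a b x :=
  (convex_lt_cross a b r).segment_subset hc hd hx

theorem exists_sub_eq_of_mem_segment {a b x y : ℝ × ℝ} (hx : x ∈ segment ℝ a b)
    (hy : y ∈ segment ℝ a b) :
    ∃ r : ℝ, y.1 - x.1 = r * (b.1 - a.1) ∧ y.2 - x.2 = r * (b.2 - a.2) := by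
  obtain ⟨s, t, -, -, h, rfl⟩ := hx
  obtain ⟨u, v, -, -, h', rfl⟩ := hy
  obtain rfl : s = 1 - t := by linarith
  obtain rfl : u = 1 - v := by linarith
  refine ⟨v - t, ?_, ?_⟩ <;>
  · simp only [Prod.fst_add, Prod.snd_add, Prod.smul_fst, Prod.smul_snd, smul_eq_mul]
    ring

/-- The orientation of the triangle cut out by three lines is determined by the cyclic order of
the directions of the lines. -/
theorem cross_nonneg_of_mem_segments {a b c d e f x y z : ℝ × ℝ}
    (hxad : x ∈ segment ℝ a d) (hzad : z ∈ segment ℝ a d)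
    (hxbe : x ∈ segment ℝ b e) (hybe : y ∈ segment ℝ b e)
    (hycf : y ∈ segment ℝ c f) (hzcf : z ∈ segment ℝ c f)
    (had_be : 0 < (d.1 - a.1) * (e.2 - b.2) - (d.2 - a.2) * (e.1 - b.1))
    (hbe_cf : 0 < (e.1 - b.1) * (f.2 - c.2) - (e.2 - b.2) * (f.1 - c.1))
    (had_cf : 0 < (d.1 - a.1) * (f.2 - c.2) - (d.2 - a.2) * (f.1 - c.1)) :
    0 ≤ Cross x z y := by
  obtain ⟨r, h1, h2⟩ := exists_sub_eq_of_mem_segment hxad hzad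
  obtain ⟨s, h3, h4⟩ := exists_sub_eq_of_mem_segment hybe hxbe
  obtain ⟨t, h5, h6⟩ := exists_sub_eq_of_mem_segment hzcf hycf
  simp only [Cross, h1, h2]
  generalize d.1 - a.1 = u₁ at *
  generalize d.2 - a.2 = u₂ at *
  generalize e.1 - b.1 = v₁ at *
  generalize e.2 - b.2 = v₂ at *
  generalize f.1 - c.1 = w₁ at *
  generalize f.2 - c.2 = w₂ at *
  have e1 : r * u₁ + s * v₁ + t * w₁ = 0 := by linarith
  have e2 : r * u₂ + s * v₂ + t * w₂ = 0 := by linarith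
  refine nonneg_of_mul_nonneg_left (b := u₁ * w₂ - u₂ * w₁) ?_ had_cf
  rw [show y.2 - x.2 = -(s * v₂) by linarith, show y.1 - x.1 = -(s * v₁) by linarith]
  have key : (r * u₁ * -(s * v₂) - r * u₂ * -(s * v₁)) * (u₁ * w₂ - u₂ * w₁) =
      s ^ 2 * (u₁ * v₂ - u₂ * v₁) * (v₁ * w₂ - v₂ * w₁) := by
    linear_combination (-s * (u₁ * v₂ - u₂ * v₁)) * (w₂ * e1 - w₁ * e2)
  rw [key]
  positivity

/-- The vertices of a counterclockwise convex hexagon: every triangle containing a side is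
positively oriented. -/
def IsCCW (p : Fin 6 → ℝ × ℝ) : Prop :=
  ∀ i j : Fin 6, j ≠ i → j ≠ i + 1 → 0 < Cross (p i) (p (i + 1)) (p j)

/-- Twice the signed area of a hexagon, split along the diagonals `02`, `03`, `35`. -/
def doubleArea (p : Fin 6 → ℝ × ℝ) : ℝ :=
  Cross (p 0) (p 1) (p 2) + Cross (p 2) (p 3) (p 0) + Cross (p 3) (p 4) (p 5) +
    Cross (p 5) (p 0) (p 3)

theorem exists_cross_le {p : Fin 6 → ℝ × ℝ} (hp : IsCCW p) :
    ∃ i : Fin 6, 6 * Cross (p (i - 1)) (p i) (p (i + 1)) ≤ doubleArea p := by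
  by_contra! hlt
  have e0 := hlt 0
  have e1 := hlt 1
  have e2 := hlt 2
  have e3 := hlt 3
  have e4 := hlt 4
  have e5 := hlt 5
  have pos (i j : Fin 6) (h : j ≠ i ∧ j ≠ i + 1) := hp i j h.1 h.2
  simp only [show (0 : Fin 6) - 1 = 5 from rfl, show (1 : Fin 6) - 1 = 0 from rfl,
    show (2 : Fin 6) - 1 = 1 from rfl, show (3 : Fin 6) - 1 = 2 from rfl,
    show (4 : Fin 6) - 1 = 3 from rfl, show (5 : Fin 6) - 1 = 4 from rfl,
    show (0 : Fin 6) + 1 = 1 from rfl, show (1 : Fin 6) + 1 = 2 from rfl,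
    show (2 : Fin 6) + 1 = 3 from rfl, show (3 : Fin 6) + 1 = 4 from rfl,
    show (4 : Fin 6) + 1 = 5 from rfl, show (5 : Fin 6) + 1 = 0 from rfl] at e0 e1 e2 e3 e4 e5
  obtain ⟨x, hx03, hx14⟩ := exists_mem_diagonals (a := p 0) (b := p 1) (c := p 3) (d := p 4)
    (pos 0 3 (by decide)) (by rw [← cross_rotate]; exact pos 3 1 (by decide))
    (pos 3 0 (by decide)) (by rw [← cross_rotate]; exact pos 0 4 (by decide))
  obtain ⟨y, hy14, hy25⟩ := exists_mem_diagonals (a := p 1) (b := p 2) (c := p 4) (d := p 5)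
    (pos 1 4 (by decide)) (by rw [← cross_rotate]; exact pos 4 2 (by decide))
    (pos 4 1 (by decide)) (by rw [← cross_rotate]; exact pos 1 5 (by decide))
  obtain ⟨z, hz25, hz30⟩ := exists_mem_diagonals (a := p 2) (b := p 3) (c := p 5) (d := p 0)
    (pos 2 5 (by decide)) (by rw [← cross_rotate]; exact pos 5 3 (by decide))
    (pos 5 2 (by decide)) (by rw [← cross_rotate]; exact pos 2 0 (by decide))
  have hz03 := segment_symm ℝ (p 3) (p 0) ▸ hz30
  have side {a b c d w : ℝ × ℝ} (hc : doubleArea p < 6 * Cross a b c)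
      (hd : doubleArea p < 6 * Cross d a b) (hw : w ∈ segment ℝ c d) :
      doubleArea p / 6 < Cross a b w :=
    lt_cross_of_mem_segment (by linarith) (by rw [cross_rotate]; linarith) hw
  have h01 := side e1 e0 hz25
  have h12 := side e2 e1 hz30
  have h23 := side e3 e2 (segment_symm ℝ (p 1) (p 4) ▸ hy14)
  have h34 := side e4 e3 (segment_symm ℝ (p 2) (p 5) ▸ hy25)
  have h45 := side e5 e4 hx03
  have h50 := side e0 e5 hx14
  have hc0 := (cross_eq_zero_of_mem_segment hx03 hz03).1
  have hc2 := (cross_eq_zero_of_mem_segment hz25 hy25).1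
  have hc4 := (cross_eq_zero_of_mem_segment hy14 hx14).2
  have hxzy : 0 ≤ Cross x z y := by
    refine cross_nonneg_of_mem_segments hx03 hz03 hx14 hy14 hy25 hz25 ?_ ?_ ?_
    · have h1 := pos 0 3 (by decide)
      have h2 := pos 3 0 (by decide)
      simp only [Cross, show (3 : Fin 6) + 1 = 4 from rfl, zero_add] at h1 h2
      linarith
    · have h1 := pos 1 4 (by decide)
      have h2 := pos 4 1 (by decide)
      simp only [Cross, show (1 : Fin 6) + 1 = 2 from rfl,
        show (4 : Fin 6) + 1 = 5 from rfl] at h1 h2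
      linarith
    · have h1 := pos 2 0 (by decide)
      have h2 := pos 5 3 (by decide)
      simp only [Cross, show (2 : Fin 6) + 1 = 3 from rfl,
        show (5 : Fin 6) + 1 = 0 from rfl] at h1 h2
      linarith
  have key : Cross (p 0) (p 1) z + Cross (p 1) (p 2) z + Cross (p 2) (p 3) y +
      Cross (p 3) (p 4) y + Cross (p 4) (p 5) x + Cross (p 5) (p 0) x +
      (Cross x (p 0) z + Cross y (p 4) x + Cross z (p 2) y) + Cross x z y = doubleArea p := by
    simp only [Cross, doubleArea]; ring
  linarith

theorem mem_convexHull_triple {a b c x : ℝ × ℝ} (habc : 0 < Cross a b c)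
    (hab : 0 ≤ Cross a b x) (hbc : 0 ≤ Cross b c x) (hca : 0 ≤ Cross c a x) :
    x ∈ convexHull ℝ {a, b, c} := by
  have hS : Cross b c x + Cross c a x + Cross a b x = Cross a b c := by
    simp only [Cross]; ring
  have hx : x = ∑ i, ![Cross b c x / Cross a b c, Cross c a x / Cross a b c,
      Cross a b x / Cross a b c] i • ![a, b, c] i := by
    simp only [Fin.sum_univ_three, Matrix.cons_val]
    ext
    · simp only [Prod.fst_add, Prod.smul_fst, smul_eq_mul]
      field_simp
      simp only [Cross]; ring
    · simp only [Prod.snd_add, Prod.smul_snd, smul_eq_mul]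
      field_simp
      simp only [Cross]; ring
  rw [hx]
  refine (convex_convexHull ℝ _).sum_mem ?_ ?_ ?_
  · intro i _
    fin_cases i <;> simp <;> positivity
  · simp only [Fin.sum_univ_three, Matrix.cons_val]
    field_simp
    exact hS
  · intro i _
    apply subset_convexHull
    fin_cases i <;> simp

theorem mem_segment_of_cross {a b c x : ℝ × ℝ} (habc : 0 < Cross a b c)
    (hab : 0 ≤ Cross a b x) (hbc : 0 ≤ Cross b c x) (hac : Cross a c x = 0) :
    x ∈ segment ℝ a c := by
  have hS : Cross b c x + Cross a b x = Cross a b c + Cross a c x := by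
    simp only [Cross]; ring
  refine ⟨Cross b c x / Cross a b c, Cross a b x / Cross a b c, by positivity, by positivity,
    by field_simp; linarith, ?_⟩
  ext
  · simp only [Prod.fst_add, Prod.smul_fst, smul_eq_mul]
    field_simp
    simp only [Cross] at hac ⊢; linear_combination b.1 * hac
  · simp only [Prod.snd_add, Prod.smul_snd, smul_eq_mul]
    field_simp
    simp only [Cross] at hac ⊢; linear_combination b.2 * hac

/-- Cutting off the ear at `b` from a convex polygon. -/
theorem convexHull_insert_subset {a b c : ℝ × ℝ} {s : Set (ℝ × ℝ)} (ha : a ∈ s) (hc : c ∈ s)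
    (habc : 0 < Cross a b c) (hab : ∀ x ∈ s, 0 ≤ Cross a b x) (hbc : ∀ x ∈ s, 0 ≤ Cross b c x) :
    convexHull ℝ (insert b s) ⊆ convexHull ℝ {a, b, c} ∪ convexHull ℝ s := by
  intro x hx
  have hab' {y} (hy : y ∈ convexHull ℝ (insert b s)) : 0 ≤ Cross a b y := by
    refine cross_nonneg_of_mem_convexHull ?_ hy
    rintro z (rfl | hz)
    · exact (cross_right a z).ge
    · exact hab z hz
  have hbc' {y} (hy : y ∈ convexHull ℝ (insert b s)) : 0 ≤ Cross b c y := by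
    refine cross_nonneg_of_mem_convexHull ?_ hy
    rintro z (rfl | hz)
    · exact (cross_left z c).ge
    · exact hbc z hz
  rcases le_or_gt (Cross a c x) 0 with hac | hac
  · exact .inl (mem_convexHull_triple habc (hab' hx) (hbc' hx) (by rw [cross_swap]; linarith))
  right
  have hx' := hx
  rw [convexHull_insert ⟨a, ha⟩, mem_convexJoin] at hx'
  obtain ⟨_, hb, y, hy, s', t, hs', ht, hst, rfl⟩ := hx'
  rw [Set.mem_singleton_iff.1 hb] at hx hac ⊢
  have hacb : Cross a c b = -Cross a b c := by simp only [Cross]; ring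
  rw [cross_combo a c b y hst, hacb] at hac
  have hfy : 0 < Cross a c y := by
    by_contra! h
    nlinarith [mul_nonneg hs' habc.le, mul_nonneg ht (neg_nonneg.2 h)]
  have hz1 : Cross a c y / (Cross a c y + Cross a b c) +
    Cross a b c / (Cross a c y + Cross a b c) = 1 := by field_simp
  have hz : (Cross a c y / (Cross a c y + Cross a b c)) • b +
      (Cross a b c / (Cross a c y + Cross a b c)) • y ∈ convexHull ℝ (insert b s) :=
    convex_convexHull ℝ _ (subset_convexHull ℝ _ (Set.mem_insert b s))
      (convexHull_mono (Set.subset_insert b s) hy) (by positivity) (by positivity) hz1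
  have hzs := (convex_convexHull ℝ s).segment_subset (subset_convexHull ℝ s ha)
    (subset_convexHull ℝ s hc) (mem_segment_of_cross habc (hab' hz) (hbc' hz)
      (by rw [cross_combo a c b y hz1, hacb]; ring))
  have hle : 0 ≤ 1 - s' * (Cross a c y + Cross a b c) / Cross a c y := by
    rw [sub_nonneg, div_le_one hfy]
    obtain rfl : t = 1 - s' := by linarith
    linarith
  convert convex_convexHull ℝ s hzs hy
    (by positivity : 0 ≤ s' * (Cross a c y + Cross a b c) / Cross a c y) hle (by ring) using 1
  obtain rfl : t = 1 - s' := by linarith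
  ext
  · simp only [Prod.fst_add, Prod.smul_fst, smul_eq_mul]
    field_simp
    ring
  · simp only [Prod.snd_add, Prod.smul_snd, smul_eq_mul]
    field_simp
    ring

theorem volume_cross_eq_zero {a b : ℝ × ℝ} (h : a ≠ b) : volume {x | Cross a b x = 0} = 0 := by
  let L : ℝ × ℝ →ₗ[ℝ] ℝ :=
    (b.1 - a.1) • LinearMap.snd ℝ ℝ ℝ - (b.2 - a.2) • LinearMap.fst ℝ ℝ ℝ
  have hL (x) : L x = (b.1 - a.1) * x.2 - (b.2 - a.2) * x.1 := by simp [L]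
  have hset : {x | Cross a b x = 0} = (AffineSubspace.mk' a (LinearMap.ker L) : Set (ℝ × ℝ)) := by
    ext x
    simp only [Set.mem_ofPred_eq, SetLike.mem_coe, AffineSubspace.mem_mk', LinearMap.mem_ker,
      vsub_eq_sub, hL, Cross, Prod.fst_sub, Prod.snd_sub]
  rw [hset]
  refine Measure.addHaar_affineSubspace volume _ fun htop => h ?_
  have hmem (v : ℝ × ℝ) : v +ᵥ a ∈ AffineSubspace.mk' a (LinearMap.ker L) := by
    rw [htop]; exact AffineSubspace.mem_top ℝ _ _
  have h1 := hmem (1, 0)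
  have h2 := hmem (0, 1)
  simp only [AffineSubspace.mem_mk', LinearMap.mem_ker, vadd_vsub, hL] at h1 h2
  ext <;> linarith

theorem volume_convexHull_ne_top {s : Set (ℝ × ℝ)} (hs : s.Finite) :
    volume (convexHull ℝ s) ≠ ⊤ :=
  (hs.isCompact_convexHull ℝ).measure_ne_top

theorem area_nonneg (s : Set (ℝ × ℝ)) : 0 ≤ area s := ENNReal.toReal_nonneg

/-- Areas of point sets separated by a line are superadditive. -/
theorem area_add_le {a b : ℝ × ℝ} {s t u : Set (ℝ × ℝ)} (hab : a ≠ b)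
    (hs : ∀ x ∈ s, 0 ≤ Cross b a x) (ht : ∀ x ∈ t, 0 ≤ Cross a b x) (hu : u.Finite)
    (hsu : s ⊆ u) (htu : t ⊆ u) : area s + area t ≤ area u := by
  have hdisj : AEDisjoint volume (convexHull ℝ s) (convexHull ℝ t) := by
    refine measure_mono_null (fun x hx => ?_) (volume_cross_eq_zero hab)
    have h1 := cross_nonneg_of_mem_convexHull hs hx.1
    have h2 := cross_nonneg_of_mem_convexHull ht hx.2
    rw [cross_swap] at h1
    exact le_antisymm (by linarith) h2
  have htm := ((hu.subset htu).isCompact_convexHull ℝ).measurableSet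
  rw [area, area, area, ← ENNReal.toReal_add (volume_convexHull_ne_top (hu.subset hsu))
    (volume_convexHull_ne_top (hu.subset htu)), ← measure_union₀ htm.nullMeasurableSet hdisj]
  exact ENNReal.toReal_mono (volume_convexHull_ne_top hu) (measure_mono
    (Set.union_subset (convexHull_mono hsu) (convexHull_mono htu)))

theorem area_triple (a b c : ℝ × ℝ) :
    area {a, b, c} = |Cross a b c| * area {(0, 0), (1, 0), (0, 1)} := by
  let L : ℝ × ℝ →ₗ[ℝ] ℝ × ℝ := Matrix.toLin (Module.Basis.finTwoProd ℝ) (Module.Basis.finTwoProd ℝ)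
    !![b.1 - a.1, c.1 - a.1; b.2 - a.2, c.2 - a.2]
  have hdet : LinearMap.det L = Cross a b c := by
    rw [LinearMap.det_toLin, Matrix.det_fin_two_of, Cross]; ring
  have himage : ({a, b, c} : Set (ℝ × ℝ)) = (a + ·) '' (L '' {(0, 0), (1, 0), (0, 1)}) := by
    simp [Set.image_insert_eq, L, Matrix.toLin_finTwoProd_apply, Prod.mk_zero_zero,
       ← Prod.mk_sub_mk]
  have hhull : convexHull ℝ {a, b, c} =
      (a + ·) '' (L '' convexHull ℝ {(0, 0), (1, 0), (0, 1)}) := by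
    rw [LinearMap.image_convexHull, himage]
    exact convexHull_vadd a _
  rw [area, area, hhull, Set.image_add_left, measure_preimage_add, Measure.addHaar_image_linearMap, hdet,
    ENNReal.toReal_mul, ENNReal.toReal_ofReal (abs_nonneg _)]

theorem ne_of_cross_pos {a b c : ℝ × ℝ} (h : 0 < Cross a b c) : a ≠ b := by
  rintro rfl
  simp [Cross] at h

theorem area_triple_add_le {a b c d : ℝ × ℝ} (habc : 0 < Cross a b c) (hcda : 0 < Cross c d a) :
    area {a, b, c} + area {c, d, a} ≤ area {a, b, c, d} := by
  have hac : 0 < Cross c a b := by rwa [← cross_rotate]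
  have hca : 0 < Cross a c d := by rwa [← cross_rotate]
  refine area_add_le (ne_of_cross_pos hca) ?_ ?_ (Set.toFinite _) ?_ ?_
  · simp [cross_left, cross_right, hac.le]
  · simp [cross_left, cross_right, hca.le]
  · simp [Set.insert_subset_iff]
  · simp [Set.insert_subset_iff]

theorem doubleArea_mul_le {p : Fin 6 → ℝ × ℝ} (hp : IsCCW p) :
    doubleArea p * area {(0, 0), (1, 0), (0, 1)} ≤ area (Set.range p) := by
  have h012 : 0 < Cross (p 0) (p 1) (p 2) := hp 0 2 (by decide) (by decide)
  have h230 : 0 < Cross (p 2) (p 3) (p 0) := hp 2 0 (by decide) (by decide)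
  have h345 : 0 < Cross (p 3) (p 4) (p 5) := hp 3 5 (by decide) (by decide)
  have h503 : 0 < Cross (p 5) (p 0) (p 3) := hp 5 3 (by decide) (by decide)
  have h301 : 0 < Cross (p 3) (p 0) (p 1) := by
    rw [← cross_rotate]; exact hp 0 3 (by decide) (by decide)
  have h302 : 0 < Cross (p 3) (p 0) (p 2) := by rwa [cross_rotate]
  have h034 : 0 < Cross (p 0) (p 3) (p 4) := by
    rw [← cross_rotate]; exact hp 3 0 (by decide) (by decide)
  have h035 : 0 < Cross (p 0) (p 3) (p 5) := by rwa [cross_rotate]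
  have h0123 := area_triple_add_le h012 h230
  have h3450 := area_triple_add_le h345 h503
  have hhex : area {p 0, p 1, p 2, p 3} + area {p 3, p 4, p 5, p 0} ≤ area (Set.range p) := by
    refine area_add_le (ne_of_cross_pos h034) ?_ ?_ (Set.toFinite _) ?_ ?_
    · simp [cross_left, cross_right, h301.le, h302.le]
    · simp [cross_left, cross_right, h034.le, h035.le]
    · simp [Set.insert_subset_iff]
    · simp [Set.insert_subset_iff]
  rw [area_triple (p 0), area_triple (p 2), abs_of_pos h012, abs_of_pos h230] at h0123
  rw [area_triple (p 3), area_triple (p 5), abs_of_pos h345, abs_of_pos h503] at h3450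
  rw [doubleArea]
  linarith

theorem area_range_le {p : Fin 6 → ℝ × ℝ} (hp : IsCCW p) (i : Fin 6) :
    area (Set.range p) ≤ area {p (i - 1), p i, p (i + 1)} + area (p '' {i}ᶜ) := by
  have hi : (i - 1) + 1 = i := sub_add_cancel i 1
  have hne : i - 1 ≠ i ∧ i + 1 ≠ i ∧ i + 1 ≠ i - 1 := by
    revert i; decide
  have hprev (j : Fin 6) (hj : j ≠ i) : 0 ≤ Cross (p (i - 1)) (p i) (p j) := by
    by_cases h : j = i - 1
    · exact h ▸ (cross_left _ _).ge
    · have := hp (i - 1) j h (by rwa [hi])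
      rw [hi] at this
      exact this.le
  have hnext (j : Fin 6) (hj : j ≠ i) : 0 ≤ Cross (p i) (p (i + 1)) (p j) := by
    by_cases h : j = i + 1
    · exact h ▸ (cross_right _ _).ge
    · exact (hp i j hj h).le
  have hpos : 0 < Cross (p (i - 1)) (p i) (p (i + 1)) := by
    have := hp (i - 1) (i + 1) hne.2.2 (by rw [hi]; exact hne.2.1)
    rwa [hi] at this
  have hsub := convexHull_insert_subset (s := p '' {i}ᶜ) (Set.mem_image_of_mem p hne.1)
    (Set.mem_image_of_mem p hne.2.1) hpos (Set.forall_mem_image.2 hprev)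
    (Set.forall_mem_image.2 hnext)
  rw [← Set.image_insert_eq, Set.insert_eq, Set.union_compl_self, Set.image_univ] at hsub
  have h1 := volume_convexHull_ne_top (Set.toFinite {p (i - 1), p i, p (i + 1)})
  have h2 := volume_convexHull_ne_top (Set.toFinite (p '' {i}ᶜ))
  rw [area, area, area, ← ENNReal.toReal_add h1 h2]
  exact ENNReal.toReal_mono (ENNReal.add_ne_top.2 ⟨h1, h2⟩)
    ((measure_mono hsub).trans (measure_union_le _ _))

theorem exists_small_ear {p : Fin 6 → ℝ × ℝ} (hp : IsCCW p) :
    ∃ i : Fin 6, area {p (i - 1), p i, p (i + 1)} ≤ 1 / 6 * area (Set.range p) ∧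
      5 / 6 * area (Set.range p) ≤ area (p '' {i}ᶜ) := by
  obtain ⟨i, hi⟩ := exists_cross_le hp
  have hpos : 0 < Cross (p (i - 1)) (p i) (p (i + 1)) := by
    have hne : i + 1 ≠ i - 1 ∧ i + 1 ≠ i := by
      clear hi; revert i; decide
    have := hp (i - 1) (i + 1) hne.1 (by rw [sub_add_cancel]; exact hne.2)
    rwa [sub_add_cancel] at this
  have hear : area {p (i - 1), p i, p (i + 1)} ≤ 1 / 6 * area (Set.range p) := by
    rw [area_triple, abs_of_pos hpos]
    have := mul_le_mul_of_nonneg_right hi (area_nonneg {(0, 0), (1, 0), (0, 1)})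
    linarith [doubleArea_mul_le hp]
  exact ⟨i, hear, by linarith [area_range_le hp i]⟩

/-- Every convex hexagon has an ear of area at most `1/6` of the area of the
hexagon; equivalently, it contains a pentagon on five of its vertices whose area
is at least `5/6` of the area of the hexagon. -/
theorem hexagon_small_ear_large_pentagon
    (p : Fin 6 → ℝ × ℝ) (hp : StrictConvexPos p) (hcyc : ConvexCyclic p) :
    (∃ i : Fin 6, area {p (i - 1), p i, p (i + 1)} ≤ (1 / 6) * area (Set.range p)) ∧
    (∃ s : Finset (Fin 6), s.card = 5 ∧
      (5 / 6) * area (Set.range p) ≤ area (p '' ↑s)) := by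
  have hcard (i : Fin 6) : ({i}ᶜ : Finset (Fin 6)).card = 5 := by
    simp [Finset.card_compl]
  rcases hcyc with h | h
  · obtain ⟨i, hear, hpent⟩ := exists_small_ear h
    exact ⟨⟨i, hear⟩, {i}ᶜ, hcard i, by simpa using hpent⟩
  · have hneg : IsCCW (p ∘ Neg.neg) := by
      intro i j hji hji'
      have := h (-(i + 1)) (-j) (neg_injective.ne hji')
        (by rw [neg_add, neg_add_cancel_right]; exact neg_injective.ne hji)
      rw [neg_add, neg_add_cancel_right, ← neg_add, cross_swap] at this
      simpa using this
    have hrange : Set.range (p ∘ Neg.neg) = Set.range p := neg_surjective.range_comp p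
    obtain ⟨i, hear, hpent⟩ := exists_small_ear hneg
    rw [hrange] at hear hpent
    refine ⟨⟨-i, ?_⟩, {-i}ᶜ, hcard _, ?_⟩
    · convert hear using 2
      simp only [Function.comp_apply, neg_sub, neg_add]
      rw [← sub_eq_add_neg, sub_eq_neg_add 1 i]
      ext; simp only [Set.mem_insert_iff, Set.mem_singleton_iff]; tauto
    · convert hpent using 2
      rw [Set.image_comp]
      simp
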